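/- Let G be a Garside group of finite type, x ∈ G, z ∈ SC(x), y = 𝔰^k(z) for a positive integer k, and let s ∈ G be positive. Then the k-fold pullback s_{(k)} of s at y is the ⪯-minimal positive element u such that s ⪯ u^{(k)} (k-fold transport at z) and z^u ∈ SSS(x). -/

import Mathlib

/-- A Garside structure of finite type on a group `G`: a submonoid `P` of positive
elements with `P ∩ P⁻¹ = {1}`, such that the prefix order `a ⪯ b ↔ a⁻¹ * b ∈ P` is a
lattice order (with meet `wedge` and join `vee`), together with a Garside element `Δ ∈ P`
whose set of prefixes (the simple elements) is finite and generates `G`, satisfying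
`Δ⁻¹ P Δ = P`, and such that every nontrivial positive element has a finite norm. -/
structure GarsideStructure (G : Type*) [Group G] where
  P : Set G
  one_mem : (1 : G) ∈ P
  mul_mem : ∀ {a b : G}, a ∈ P → b ∈ P → a * b ∈ P
  eq_one_of_mem_of_inv_mem : ∀ a : G, a ∈ P → a⁻¹ ∈ P → a = 1
  wedge : G → G → G
  vee : G → G → G
  wedge_le_left : ∀ a b : G, (wedge a b)⁻¹ * a ∈ P
  wedge_le_right : ∀ a b : G, (wedge a b)⁻¹ * b ∈ P
  le_wedge : ∀ a b c : G, c⁻¹ * a ∈ P → c⁻¹ * b ∈ P → c⁻¹ * wedge a b ∈ P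
  le_vee_left : ∀ a b : G, a⁻¹ * vee a b ∈ P
  le_vee_right : ∀ a b : G, b⁻¹ * vee a b ∈ P
  vee_le : ∀ a b c : G, a⁻¹ * c ∈ P → b⁻¹ * c ∈ P → (vee a b)⁻¹ * c ∈ P
  Δ : G
  Δ_mem : Δ ∈ P
  simples_finite : {s : G | s ∈ P ∧ s⁻¹ * Δ ∈ P}.Finite
  simples_generate : Subgroup.closure {s : G | s ∈ P ∧ s⁻¹ * Δ ∈ P} = (⊤ : Subgroup G)
  conj_Delta_mem : ∀ a : G, a ∈ P → Δ⁻¹ * a * Δ ∈ P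
  mem_of_conj_Delta_mem : ∀ a : G, Δ⁻¹ * a * Δ ∈ P → a ∈ P
  norm_bounded : ∀ x : G, x ∈ P → x ≠ 1 →
    ∃ n : ℕ, ∀ L : List G, (∀ a ∈ L, a ∈ P ∧ a ≠ 1) → L.prod = x → L.length ≤ n

namespace GarsideStructure

variable {G : Type*} [Group G] (gs : GarsideStructure G)

/-- The prefix order: `a ⪯ b`. -/
def pre (a b : G) : Prop := a⁻¹ * b ∈ gs.P

/-- The suffix order: `a ≽ b` (i.e. `b` is a suffix of `a`). -/
def rdvd (a b : G) : Prop := a * b⁻¹ ∈ gs.P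

/-- Greatest common divisor with respect to the suffix order `≽` : `a ∧↰ b`. -/
def rwedge (a b : G) : G := (gs.vee a⁻¹ b⁻¹)⁻¹

/-- Least common multiple with respect to the suffix order `≽` : `a ∨↰ b`. -/
def rvee (a b : G) : G := (gs.wedge a⁻¹ b⁻¹)⁻¹

/-- Simple elements: positive prefixes of `Δ`. -/
def simple (s : G) : Prop := s ∈ gs.P ∧ s⁻¹ * gs.Δ ∈ gs.P

/-- Atoms: nontrivial positive elements which cannot be decomposed in `P`. -/
def atom (a : G) : Prop := a ∈ gs.P ∧ a ≠ 1 ∧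
  ∀ b c : G, b ∈ gs.P → c ∈ gs.P → a = b * c → b = 1 ∨ c = 1

/-- `inf x` : the maximal integer `p` with `Δ^p ⪯ x`. -/
noncomputable def ginf (x : G) : ℤ := sSup {p : ℤ | gs.pre (gs.Δ ^ p) x}

/-- `sup x` : the minimal integer `p` with `x ⪯ Δ^p`. -/
noncomputable def gsup (x : G) : ℤ := sInf {p : ℤ | gs.pre x (gs.Δ ^ p)}

/-- Canonical length `ℓ(x) = sup(x) - inf(x)`. -/
noncomputable def glen (x : G) : ℤ := gs.gsup x - gs.ginf x

/-- `‖x‖` : the maximal number of factors in a decomposition of `x` as a product of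
nontrivial positive elements. -/
noncomputable def gnorm (x : G) : ℕ :=
  sSup {k : ℕ | ∃ L : List G, (∀ a ∈ L, a ∈ gs.P ∧ a ≠ 1) ∧ L.prod = x ∧ L.length = k}

/-- The summit infimum `inf_s(x)` : the maximum of `inf` over the conjugacy class of `x`. -/
noncomputable def ginfs (x : G) : ℤ :=
  sSup {p : ℤ | ∃ y : G, (∃ α : G, α⁻¹ * x * α = y) ∧ p = gs.ginf y}

/-- The summit supremum `sup_s(x)` : the minimum of `sup` over the conjugacy class of `x`. -/
noncomputable def gsups (x : G) : ℤ :=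
  sInf {p : ℤ | ∃ y : G, (∃ α : G, α⁻¹ * x * α = y) ∧ p = gs.gsup y}

/-- The preferred prefix `𝔭(x) = (xΔ^{-inf x}) ∧ (x⁻¹Δ^{sup x}) ∧ Δ`. -/
noncomputable def pp (x : G) : G :=
  gs.wedge (gs.wedge (x * gs.Δ ^ (-gs.ginf x)) (x⁻¹ * gs.Δ ^ gs.gsup x)) gs.Δ

/-- Cyclic (left) sliding `𝔰(x) = 𝔭(x)⁻¹ x 𝔭(x)`. -/
noncomputable def sl (x : G) : G := (gs.pp x)⁻¹ * x * gs.pp x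

/-- The preferred suffix `𝔭↰(x) = (Δ^{-inf x}x) ∧↰ (Δ^{sup x}x⁻¹) ∧↰ Δ`. -/
noncomputable def ps (x : G) : G :=
  gs.rwedge (gs.rwedge (gs.Δ ^ (-gs.ginf x) * x) (gs.Δ ^ gs.gsup x * x⁻¹)) gs.Δ

/-- Cyclic right sliding `𝔰↰(x) = 𝔭↰(x) x 𝔭↰(x)⁻¹`. -/
noncomputable def rsl (x : G) : G := gs.ps x * x * (gs.ps x)⁻¹

/-- The super summit set `SSS(x)` : conjugates of `x` with maximal infimum and minimal
supremum among all conjugates of `x`. -/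
def SSS (x : G) : Set G :=
  {y | (∃ α : G, α⁻¹ * x * α = y) ∧
    ∀ z : G, (∃ α : G, α⁻¹ * x * α = z) → gs.ginf z ≤ gs.ginf y ∧ gs.gsup y ≤ gs.gsup z}

/-- The set of sliding circuits `SC(x)` : conjugates `y` of `x` with `𝔰^m(y) = y` for
some `m ≥ 1`. -/
noncomputable def SC (x : G) : Set G :=
  {y | (∃ α : G, α⁻¹ * x * α = y) ∧ ∃ m : ℕ, 1 ≤ m ∧ (gs.sl)^[m] y = y}

/-- The transport `α^{(1)} = 𝔭(x)⁻¹ α 𝔭(x^α)` of `α` at `x`. -/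
noncomputable def transport (x α : G) : G := (gs.pp x)⁻¹ * α * gs.pp (α⁻¹ * x * α)

/-- Iterated transport `α^{(i)}` of `α` at `x`: `α^{(0)} = α` and `α^{(i+1)}` is the
transport of `α^{(i)}` at `𝔰^i(x)`. -/
noncomputable def transportIter (x α : G) : ℕ → G
  | 0 => α
  | i + 1 => gs.transport ((gs.sl)^[i] x) (transportIter x α i)

/-- `c` is the `⪯`-minimal element `c_s(y)` satisfying `s ⪯ c` and `y^c ∈ SC(x)`. -/
def IsMinSCConj (x y s c : G) : Prop :=
  gs.pre s c ∧ (c⁻¹ * y * c) ∈ gs.SC x ∧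
    ∀ d : G, gs.pre s d → (d⁻¹ * y * d) ∈ gs.SC x → gs.pre c d

/-- `s` is an indecomposable conjugator starting at `u`: `u^s ∈ SC(x)`, `s ≠ 1` and there
is no `t` with `1 ≺ t ≺ s` and `u^t ∈ SC(x)`. -/
def IsIndecomposableConjugator (x u s : G) : Prop :=
  (s⁻¹ * u * s) ∈ gs.SC x ∧ s ≠ 1 ∧
    ¬ ∃ t : G, (gs.pre 1 t ∧ t ≠ 1) ∧ (gs.pre t s ∧ t ≠ s) ∧ (t⁻¹ * u * t) ∈ gs.SC x

/-- `u` is the pullback of `s` at `y = 𝔰(z)` : the `⪯`-minimal positive element with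
`z^u ∈ SSS(x)` and `s ⪯ u^{(1)}` (transport at `z`). -/
def IsPullback (x z s u : G) : Prop :=
  u ∈ gs.P ∧ (u⁻¹ * z * u) ∈ gs.SSS x ∧ gs.pre s (gs.transport z u) ∧
    ∀ u' : G, u' ∈ gs.P → (u'⁻¹ * z * u') ∈ gs.SSS x → gs.pre s (gs.transport z u') →
      gs.pre u u'

/-- The pullback `s_{(1)}` of `s` at `y = 𝔰(z)`. -/
noncomputable def pullbackOne (x z s : G) : G :=
  @Classical.epsilon G ⟨1⟩ (fun u => gs.IsPullback x z s u)

/-- The `k`-fold pullback `s_{(k)}` of `s` at `y = 𝔰^k(z)` (an element at `z`):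
`s_{(0)} = s` and `s_{(k+1)}` is the pullback at `𝔰(z)` (relative to `z`) of the `k`-fold
pullback of `s` at `𝔰^k(𝔰(z)) = y`. -/
noncomputable def pullbackIter (x : G) : G → ℕ → G → G
  | _, 0, s => s
  | z, k + 1, s => gs.pullbackOne x z (pullbackIter x (gs.sl z) k s)

end GarsideStructure

open GarsideStructure

variable {G : Type*} [Group G]

namespace GarsideStructure

/-! ### The prefix order -/

section Order

variable (gs : GarsideStructure G)

lemma pre_refl (a : G) : gs.pre a a := by
  simpa [pre] using gs.one_mem

lemma pre_trans {a b c : G} (hab : gs.pre a b) (hbc : gs.pre b c) : gs.pre a c := by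
  have h := gs.mul_mem hab hbc
  simpa [pre, mul_assoc] using h

lemma pre_antisymm {a b : G} (hab : gs.pre a b) (hba : gs.pre b a) : a = b := by
  have h := gs.eq_one_of_mem_of_inv_mem (a⁻¹ * b) hab (by simpa [pre] using hba)
  exact inv_mul_eq_one.mp h

lemma one_pre_iff {a : G} : gs.pre 1 a ↔ a ∈ gs.P := by simp [pre]

lemma mul_pre_mul_left_iff (g : G) {a b : G} : gs.pre (g * a) (g * b) ↔ gs.pre a b := by
  simp [pre, mul_assoc]

lemma pre_mul_of_mem {a b : G} (hb : b ∈ gs.P) : gs.pre a (a * b) := by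
  simpa [pre] using hb

lemma conj_zpow_mem_iff (n : ℤ) (c : G) : gs.Δ ^ (-n) * c * gs.Δ ^ n ∈ gs.P ↔ c ∈ gs.P := by
  have step : ∀ d : G, gs.Δ⁻¹ * d * gs.Δ ∈ gs.P ↔ d ∈ gs.P :=
    fun d => ⟨gs.mem_of_conj_Delta_mem d, gs.conj_Delta_mem d⟩
  induction n using Int.induction_on with
  | zero => simp
  | succ n ih =>
    refine Iff.trans ?_ ih
    rw [← step (gs.Δ ^ (-(n : ℤ)) * c * gs.Δ ^ (n : ℤ))]
    have : gs.Δ ^ (-((n : ℤ) + 1)) * c * gs.Δ ^ ((n : ℤ) + 1) =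
        gs.Δ⁻¹ * (gs.Δ ^ (-(n : ℤ)) * c * gs.Δ ^ (n : ℤ)) * gs.Δ := by group
    rw [this]
  | pred n ih =>
    refine Iff.trans ?_ ih
    rw [← step (gs.Δ ^ (-(-(n : ℤ) - 1)) * c * gs.Δ ^ (-(n : ℤ) - 1))]
    have : gs.Δ⁻¹ * (gs.Δ ^ (-(-(n : ℤ) - 1)) * c * gs.Δ ^ (-(n : ℤ) - 1)) * gs.Δ =
        gs.Δ ^ (-(-(n : ℤ))) * c * gs.Δ ^ (-(n : ℤ)) := by group
    rw [this]

lemma mul_zpow_pre_mul_zpow_iff (n : ℤ) {a b : G} :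
    gs.pre (a * gs.Δ ^ n) (b * gs.Δ ^ n) ↔ gs.pre a b := by
  unfold pre
  rw [← gs.conj_zpow_mem_iff n (a⁻¹ * b)]
  simp [mul_assoc]

lemma zpow_pre_mul_zpow {n : ℤ} {a : G} (ha : a ∈ gs.P) : gs.pre (gs.Δ ^ n) (a * gs.Δ ^ n) := by
  simpa using (gs.mul_zpow_pre_mul_zpow_iff n (a := 1)).2 (gs.one_pre_iff.2 ha)

lemma Delta_pow_mem (n : ℕ) : gs.Δ ^ n ∈ gs.P := by
  induction n with
  | zero => simpa using gs.one_mem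
  | succ n ih => rw [pow_succ]; exact gs.mul_mem ih gs.Δ_mem

lemma zpow_pre_zpow {m n : ℤ} (h : m ≤ n) : gs.pre (gs.Δ ^ m) (gs.Δ ^ n) := by
  obtain ⟨k, rfl⟩ := Int.le.dest h
  have := gs.Delta_pow_mem k
  simpa [pre, zpow_add] using this

lemma pre_wedge_iff {a b c : G} : gs.pre c (gs.wedge a b) ↔ gs.pre c a ∧ gs.pre c b :=
  ⟨fun h => ⟨gs.pre_trans h (gs.wedge_le_left a b), gs.pre_trans h (gs.wedge_le_right a b)⟩,
    fun h => gs.le_wedge a b c h.1 h.2⟩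

lemma eq_of_forall_pre_iff {a b : G} (h : ∀ c, gs.pre c a ↔ gs.pre c b) : a = b :=
  gs.pre_antisymm ((h a).1 (gs.pre_refl a)) ((h b).2 (gs.pre_refl b))

lemma pre_mul_left_iff (g : G) {a c : G} : gs.pre c (g * a) ↔ gs.pre (g⁻¹ * c) a := by
  simp [pre, mul_assoc]

lemma mul_wedge (g a b : G) : g * gs.wedge a b = gs.wedge (g * a) (g * b) := by
  refine gs.eq_of_forall_pre_iff fun c => ?_
  simp only [pre_wedge_iff, pre_mul_left_iff gs g]

lemma pre_mul_zpow_iff (n : ℤ) {a c : G} :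
    gs.pre c (a * gs.Δ ^ n) ↔ gs.pre (c * gs.Δ ^ (-n)) a := by
  rw [← gs.mul_zpow_pre_mul_zpow_iff n (a := c * gs.Δ ^ (-n))]
  simp [mul_assoc]

lemma wedge_mul_zpow (n : ℤ) (a b : G) :
    gs.wedge a b * gs.Δ ^ n = gs.wedge (a * gs.Δ ^ n) (b * gs.Δ ^ n) := by
  refine gs.eq_of_forall_pre_iff fun c => ?_
  simp only [pre_wedge_iff, pre_mul_zpow_iff gs n]

lemma wedge_mul_Delta (a b : G) :
    gs.wedge a b * gs.Δ = gs.wedge (a * gs.Δ) (b * gs.Δ) := by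
  simpa using gs.wedge_mul_zpow 1 a b

lemma wedge_mem {a b : G} (ha : a ∈ gs.P) (hb : b ∈ gs.P) : gs.wedge a b ∈ gs.P := by
  rw [← one_pre_iff] at *
  exact gs.pre_wedge_iff.2 ⟨ha, hb⟩

end Order

/-! ### Conjugators bounding the infimum and the supremum -/

section Conjugators

variable (gs : GarsideStructure G)

lemma zpow_pre_conj_iff {c : ℤ} {x α : G} :
    gs.pre (gs.Δ ^ c) (α⁻¹ * x * α) ↔ gs.pre (α * gs.Δ ^ c) (x * α) := by
  simp [pre, mul_assoc]

lemma conj_pre_zpow_iff {c : ℤ} {x α : G} :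
    gs.pre (α⁻¹ * x * α) (gs.Δ ^ c) ↔ gs.pre (x * α) (α * gs.Δ ^ c) := by
  simp [pre, mul_assoc]

lemma zpow_pre_conj_wedge {c : ℤ} {x α β : G}
    (hα : gs.pre (gs.Δ ^ c) (α⁻¹ * x * α)) (hβ : gs.pre (gs.Δ ^ c) (β⁻¹ * x * β)) :
    gs.pre (gs.Δ ^ c) ((gs.wedge α β)⁻¹ * x * gs.wedge α β) := by
  rw [zpow_pre_conj_iff] at *
  rw [wedge_mul_zpow, mul_wedge, pre_wedge_iff]
  exact ⟨gs.pre_trans (gs.wedge_le_left _ _) hα, gs.pre_trans (gs.wedge_le_right _ _) hβ⟩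

lemma conj_wedge_pre_zpow {c : ℤ} {x α β : G}
    (hα : gs.pre (α⁻¹ * x * α) (gs.Δ ^ c)) (hβ : gs.pre (β⁻¹ * x * β) (gs.Δ ^ c)) :
    gs.pre ((gs.wedge α β)⁻¹ * x * gs.wedge α β) (gs.Δ ^ c) := by
  rw [conj_pre_zpow_iff] at *
  rw [wedge_mul_zpow, mul_wedge, pre_wedge_iff]
  exact ⟨gs.pre_trans (gs.wedge_le_left _ _) hα, gs.pre_trans (gs.wedge_le_right _ _) hβ⟩

lemma zpow_pre_conj_zpow_iff {c : ℤ} (n : ℤ) {x : G} :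
    gs.pre (gs.Δ ^ c) ((gs.Δ ^ n)⁻¹ * x * gs.Δ ^ n) ↔ gs.pre (gs.Δ ^ c) x := by
  rw [zpow_pre_conj_iff, ← zpow_add, add_comm, zpow_add, mul_zpow_pre_mul_zpow_iff]

lemma conj_zpow_pre_zpow_iff {c : ℤ} (n : ℤ) {x : G} :
    gs.pre ((gs.Δ ^ n)⁻¹ * x * gs.Δ ^ n) (gs.Δ ^ c) ↔ gs.pre x (gs.Δ ^ c) := by
  rw [conj_pre_zpow_iff, ← zpow_add, add_comm, zpow_add, mul_zpow_pre_mul_zpow_iff]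

lemma zpow_neg_pre_inv_iff {c : ℤ} {x : G} :
    gs.pre (gs.Δ ^ (-c)) x⁻¹ ↔ gs.pre x (gs.Δ ^ c) := by
  unfold pre
  rw [← gs.conj_zpow_mem_iff c]
  simp

lemma inv_pre_zpow_neg_iff {c : ℤ} {x : G} :
    gs.pre x⁻¹ (gs.Δ ^ (-c)) ↔ gs.pre (gs.Δ ^ c) x := by
  rw [← zpow_neg_pre_inv_iff, neg_neg, inv_inv]

end Conjugators

/-! ### Infimum and supremum -/

section InfSup

variable (gs : GarsideStructure G)

lemma exists_zpow_pre_pre_zpow (g : G) :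
    ∃ p q : ℤ, gs.pre (gs.Δ ^ p) g ∧ gs.pre g (gs.Δ ^ q) := by
  have hg : g ∈ Subgroup.closure {s : G | s ∈ gs.P ∧ s⁻¹ * gs.Δ ∈ gs.P} := by
    rw [gs.simples_generate]; trivial
  induction hg using Subgroup.closure_induction with
  | mem s hs => exact ⟨0, 1, by simpa [pre] using hs.1, by simpa [pre] using hs.2⟩
  | one => exact ⟨0, 0, by simpa using gs.pre_refl 1, by simpa using gs.pre_refl 1⟩
  | mul g h _ _ ihg ihh =>
    obtain ⟨p, q, hp, hq⟩ := ihg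
    obtain ⟨p', q', hp', hq'⟩ := ihh
    refine ⟨p + p', q + q', ?_, ?_⟩
    · rw [zpow_add]
      exact gs.pre_trans ((gs.mul_zpow_pre_mul_zpow_iff _).2 hp)
        ((gs.mul_pre_mul_left_iff _).2 hp')
    · rw [zpow_add]
      exact gs.pre_trans ((gs.mul_pre_mul_left_iff _).2 hq')
        ((gs.mul_zpow_pre_mul_zpow_iff _).2 hq)
  | inv g _ ih =>
    obtain ⟨p, q, hp, hq⟩ := ih
    exact ⟨-q, -p, gs.zpow_neg_pre_inv_iff.2 hq, gs.inv_pre_zpow_neg_iff.2 hp⟩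

lemma subsingleton_of_Delta_eq_one (h : gs.Δ = 1) : Subsingleton G := by
  have key : ∀ g : G, g = 1 := fun g => by
    obtain ⟨p, q, hp, hq⟩ := gs.exists_zpow_pre_pre_zpow g
    rw [h, one_zpow] at hp hq
    exact gs.pre_antisymm hq hp
  exact ⟨fun a b => (key a).trans (key b).symm⟩

lemma zpow_pre_zpow_iff (hΔ : gs.Δ ≠ 1) {m n : ℤ} :
    gs.pre (gs.Δ ^ m) (gs.Δ ^ n) ↔ m ≤ n := by
  refine ⟨fun h => ?_, gs.zpow_pre_zpow⟩
  by_contra! hlt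
  have h1 : gs.Δ ^ m = gs.Δ ^ n := gs.pre_antisymm h (gs.zpow_pre_zpow hlt.le)
  have h2 : gs.pre (gs.Δ ^ (n + 1)) (gs.Δ ^ m) := gs.zpow_pre_zpow hlt
  have h3 : gs.Δ ^ (n + 1) = gs.Δ ^ n :=
    gs.pre_antisymm (h1 ▸ h2) (gs.zpow_pre_zpow (by omega))
  rw [zpow_add_one] at h3
  exact hΔ (mul_eq_left.mp h3)

lemma le_ginf_iff (hΔ : gs.Δ ≠ 1) {p : ℤ} {x : G} :
    p ≤ gs.ginf x ↔ gs.pre (gs.Δ ^ p) x := by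
  obtain ⟨p₀, q₀, hp₀, hq₀⟩ := gs.exists_zpow_pre_pre_zpow x
  have hbdd : BddAbove {p : ℤ | gs.pre (gs.Δ ^ p) x} :=
    ⟨q₀, fun r hr => (gs.zpow_pre_zpow_iff hΔ).1 (gs.pre_trans hr hq₀)⟩
  have hmem : gs.pre (gs.Δ ^ gs.ginf x) x := Int.csSup_mem ⟨p₀, hp₀⟩ hbdd
  exact ⟨fun h => gs.pre_trans (gs.zpow_pre_zpow h) hmem, fun h => le_csSup hbdd h⟩

lemma gsup_le_iff (hΔ : gs.Δ ≠ 1) {q : ℤ} {x : G} :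
    gs.gsup x ≤ q ↔ gs.pre x (gs.Δ ^ q) := by
  obtain ⟨p₀, q₀, hp₀, hq₀⟩ := gs.exists_zpow_pre_pre_zpow x
  have hbdd : BddBelow {q : ℤ | gs.pre x (gs.Δ ^ q)} :=
    ⟨p₀, fun r hr => (gs.zpow_pre_zpow_iff hΔ).1 (gs.pre_trans hp₀ hr)⟩
  have hmem : gs.pre x (gs.Δ ^ gs.gsup x) := Int.csInf_mem ⟨q₀, hq₀⟩ hbdd
  exact ⟨fun h => gs.pre_trans hmem (gs.zpow_pre_zpow h), fun h => csInf_le hbdd h⟩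

end InfSup

/-! ### Bounds on decompositions of positive elements -/

section Norm

variable (gs : GarsideStructure G)

/-- Every decomposition of `x` into nontrivial positive factors has at most `n` factors. -/
def NormLE (x : G) (n : ℕ) : Prop :=
  ∀ L : List G, (∀ a ∈ L, a ∈ gs.P ∧ a ≠ 1) → L.prod = x → L.length ≤ n

lemma list_prod_mem {L : List G} (hL : ∀ a ∈ L, a ∈ gs.P ∧ a ≠ 1) : L.prod ∈ gs.P := by
  induction L with
  | nil => simpa using gs.one_mem
  | cons a L ih =>
    rw [List.prod_cons]
    exact gs.mul_mem (hL a (by simp)).1 (ih fun b hb => hL b (by simp [hb]))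

lemma exists_normLE {x : G} (hx : x ∈ gs.P) : ∃ n, gs.NormLE x n := by
  by_cases h : x = 1
  · refine ⟨0, fun L hL hprod => ?_⟩
    cases L with
    | nil => simp
    | cons a L =>
      exfalso
      rw [List.prod_cons, h] at hprod
      have ha := hL a (by simp)
      refine ha.2 (gs.eq_one_of_mem_of_inv_mem a ha.1 ?_)
      rw [inv_eq_of_mul_eq_one_right hprod]
      exact gs.list_prod_mem fun b hb => hL b (by simp [hb])
  · exact gs.norm_bounded x hx h

lemma exists_normLE_lt_of_mul {x c : G} {n : ℕ} (hc : c ∈ gs.P) (hc1 : c ≠ 1)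
    (h : gs.NormLE (x * c) n) (hx : x ∈ gs.P) : ∃ m, m < n ∧ gs.NormLE x m := by
  have key : ∀ L : List G, (∀ a ∈ L, a ∈ gs.P ∧ a ≠ 1) → L.prod = x → L.length + 1 ≤ n := by
    intro L hL hprod
    have := h (L ++ [c]) (by
      intro a ha
      rcases List.mem_append.1 ha with ha | ha
      · exact hL a ha
      · rw [List.mem_singleton.1 ha]; exact ⟨hc, hc1⟩) (by simp [hprod])
    simpa using this
  have hn : 0 < n := by
    by_cases h1 : x = 1
    · have := key [] (by simp) (by simp [h1])
      omega
    · have := key [x] (by simp [hx, h1]) (by simp)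
      omega
  exact ⟨n - 1, by omega, fun L hL hprod => by have := key L hL hprod; omega⟩

lemma normLE_conj_Delta {x : G} {n : ℕ} (h : gs.NormLE x n) :
    gs.NormLE (gs.Δ⁻¹ * x * gs.Δ) n := by
  intro L hL hprod
  have := h (L.map (MulAut.conj gs.Δ)) (by
    intro a ha
    obtain ⟨b, hb, rfl⟩ := List.mem_map.1 ha
    refine ⟨gs.mem_of_conj_Delta_mem _ ?_, ?_⟩
    · simpa [MulAut.conj_apply, mul_assoc] using (hL b hb).1
    · simpa using (hL b hb).2) (by
    rw [← map_list_prod, hprod]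
    simp [MulAut.conj_apply, mul_assoc])
  simpa using this

/-- A nonempty set of positive elements closed under `∧` has a least element. -/
lemma exists_least {U : Set G} (hne : U.Nonempty) (hP : ∀ u ∈ U, u ∈ gs.P)
    (hU : ∀ u ∈ U, ∀ v ∈ U, gs.wedge u v ∈ U) : ∃ u ∈ U, ∀ v ∈ U, gs.pre u v := by
  classical
  have hex : ∃ n, ∃ u ∈ U, gs.NormLE u n := by
    obtain ⟨u, hu⟩ := hne
    obtain ⟨n, hn⟩ := gs.exists_normLE (hP u hu)
    exact ⟨n, u, hu, hn⟩
  obtain ⟨u, hu, hn⟩ := Nat.find_spec hex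
  refine ⟨u, hu, fun v hv => ?_⟩
  have hw := hU u hu v hv
  by_cases hc : (gs.wedge u v)⁻¹ * u = 1
  · have h := gs.wedge_le_right u v
    rwa [inv_mul_eq_one.mp hc] at h
  · obtain ⟨m, hm, hm'⟩ := gs.exists_normLE_lt_of_mul (gs.wedge_le_left u v) hc
      (by simpa using hn) (hP _ hw)
    exact absurd ⟨_, hw, hm'⟩ (Nat.find_min hex hm)

end Norm

/-! ### Cycling and sliding relative to fixed bounds -/

section Relative

variable (gs : GarsideStructure G)

/-- The initial factor `xΔ^{-a} ∧ Δ` of `x` relative to the bound `a` for the infimum. -/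
def initialFactor (a : ℤ) (x : G) : G := gs.wedge (x * gs.Δ ^ (-a)) gs.Δ

/-- Cycling relative to the bound `a` for the infimum. -/
def cycling (a : ℤ) (x : G) : G := (gs.initialFactor a x)⁻¹ * x * gs.initialFactor a x

/-- The preferred prefix of `x` relative to bounds `a` and `b` for infimum and supremum. -/
def relPrefix (a b : ℤ) (x : G) : G :=
  gs.wedge (gs.wedge (x * gs.Δ ^ (-a)) (x⁻¹ * gs.Δ ^ b)) gs.Δ

/-- Cyclic sliding relative to bounds `a` and `b` for infimum and supremum. -/
def relSliding (a b : ℤ) (x : G) : G := (gs.relPrefix a b x)⁻¹ * x * gs.relPrefix a b x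

lemma mul_relPrefix_conj (a b : ℤ) (x α : G) :
    α * gs.relPrefix a b (α⁻¹ * x * α) =
      gs.wedge (gs.wedge (x * α * gs.Δ ^ (-a)) (x⁻¹ * α * gs.Δ ^ b)) (α * gs.Δ) := by
  simp only [relPrefix, mul_wedge, mul_inv_rev, inv_inv, mul_assoc, mul_inv_cancel_left]

lemma relPrefix_mul_initialFactor (a b : ℤ) (x : G) :
    gs.relPrefix a b x * gs.initialFactor a (gs.relSliding a b x) =
      gs.initialFactor a x * gs.relPrefix a b (gs.cycling a x) := by
  have h1 : gs.relPrefix a b x * gs.initialFactor a (gs.relSliding a b x) =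
      gs.wedge (x * gs.relPrefix a b x * gs.Δ ^ (-a)) (gs.relPrefix a b x * gs.Δ ^ (1 : ℤ)) := by
    simp only [initialFactor, relSliding, mul_wedge, mul_assoc, mul_inv_cancel_left, zpow_one]
  have h2 : gs.initialFactor a x * gs.relPrefix a b (gs.cycling a x) =
      gs.wedge (gs.wedge (x * gs.initialFactor a x * gs.Δ ^ (-a))
        (x⁻¹ * gs.initialFactor a x * gs.Δ ^ b)) (gs.initialFactor a x * gs.Δ ^ (1 : ℤ)) := by
    rw [cycling, mul_relPrefix_conj, zpow_one]
  have e1 : gs.Δ ^ b * gs.Δ ^ (-a) = gs.Δ ^ (-a) * gs.Δ ^ b := by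
    rw [← zpow_add, ← zpow_add, add_comm]
  have e2 : gs.Δ * gs.Δ ^ (-a) = gs.Δ ^ (-a) * gs.Δ := by
    rw [← zpow_one_add, ← zpow_add_one, add_comm]
  have e3 : gs.Δ * gs.Δ ^ b = gs.Δ ^ b * gs.Δ := by
    rw [← zpow_one_add, ← zpow_add_one, add_comm]
  rw [h1, h2]
  refine gs.eq_of_forall_pre_iff fun c => ?_
  simp only [initialFactor, relPrefix, mul_wedge, wedge_mul_zpow, wedge_mul_Delta, pre_wedge_iff, mul_assoc,
    mul_inv_cancel_left, inv_mul_cancel_left, zpow_one, e1, e2, e3]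
  tauto

lemma conj_conj (x u v : G) : v⁻¹ * (u⁻¹ * x * u) * v = (u * v)⁻¹ * x * (u * v) := by
  simp only [mul_inv_rev, mul_assoc]

lemma cycling_relSliding (a b : ℤ) (x : G) :
    gs.cycling a (gs.relSliding a b x) = gs.relSliding a b (gs.cycling a x) := by
  have h := gs.relPrefix_mul_initialFactor a b x
  calc gs.cycling a (gs.relSliding a b x)
      = (gs.relPrefix a b x * gs.initialFactor a (gs.relSliding a b x))⁻¹ * x *
          (gs.relPrefix a b x * gs.initialFactor a (gs.relSliding a b x)) := conj_conj _ _ _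
    _ = gs.relSliding a b (gs.cycling a x) := by rw [h]; exact (conj_conj _ _ _).symm

lemma relSliding_inv (a b : ℤ) (x : G) :
    gs.relSliding (-b) (-a) x⁻¹ = (gs.relSliding a b x)⁻¹ := by
  have h : gs.relPrefix (-b) (-a) x⁻¹ = gs.relPrefix a b x := by
    refine gs.eq_of_forall_pre_iff fun c => ?_
    simp only [relPrefix, pre_wedge_iff, neg_neg, inv_inv]
    tauto
  simp only [relSliding, h, mul_inv_rev, inv_inv, mul_assoc]

lemma conj_self_mul (x u : G) : (x * u)⁻¹ * x * (x * u) = u⁻¹ * x * u := by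
  simp only [mul_inv_rev, mul_assoc, inv_mul_cancel_left]

lemma conj_inv_self_mul (x u : G) : (x⁻¹ * u)⁻¹ * x * (x⁻¹ * u) = u⁻¹ * x * u := by
  simp only [mul_inv_rev, inv_inv, mul_assoc, mul_inv_cancel_left]

lemma zpow_pre_cycling {a c : ℤ} {x : G} (hc : gs.pre (gs.Δ ^ c) x) :
    gs.pre (gs.Δ ^ c) (gs.cycling a x) := by
  refine gs.zpow_pre_conj_wedge ?_ ?_
  · rw [conj_self_mul]
    exact (gs.zpow_pre_conj_zpow_iff _).2 hc
  · simpa using (gs.zpow_pre_conj_zpow_iff 1).2 hc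

lemma cycling_pre_zpow {a c : ℤ} {x : G} (hc : gs.pre x (gs.Δ ^ c)) :
    gs.pre (gs.cycling a x) (gs.Δ ^ c) := by
  refine gs.conj_wedge_pre_zpow ?_ ?_
  · rw [conj_self_mul]
    exact (gs.conj_zpow_pre_zpow_iff _).2 hc
  · simpa using (gs.conj_zpow_pre_zpow_iff 1).2 hc

lemma zpow_pre_relSliding {a b c : ℤ} {x : G} (hc : gs.pre (gs.Δ ^ c) x) :
    gs.pre (gs.Δ ^ c) (gs.relSliding a b x) := by
  refine gs.zpow_pre_conj_wedge (gs.zpow_pre_conj_wedge ?_ ?_) ?_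
  · rw [conj_self_mul]
    exact (gs.zpow_pre_conj_zpow_iff _).2 hc
  · rw [conj_inv_self_mul]
    exact (gs.zpow_pre_conj_zpow_iff _).2 hc
  · simpa using (gs.zpow_pre_conj_zpow_iff 1).2 hc

lemma relSliding_pre_zpow {a b c : ℤ} {x : G} (hc : gs.pre x (gs.Δ ^ c)) :
    gs.pre (gs.relSliding a b x) (gs.Δ ^ c) := by
  refine gs.conj_wedge_pre_zpow (gs.conj_wedge_pre_zpow ?_ ?_) ?_
  · rw [conj_self_mul]
    exact (gs.conj_zpow_pre_zpow_iff _).2 hc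
  · rw [conj_inv_self_mul]
    exact (gs.conj_zpow_pre_zpow_iff _).2 hc
  · simpa using (gs.conj_zpow_pre_zpow_iff 1).2 hc

/-- If cycling increases the infimum, then so does cyclic sliding. -/
lemma zpow_pre_relSliding_of_cycling {a b : ℤ} {x : G} (hb : gs.pre x (gs.Δ ^ b))
    (h : gs.pre (gs.Δ ^ (a + 1)) (gs.cycling a x)) :
    gs.pre (gs.Δ ^ (a + 1)) (gs.relSliding a b x) := by
  rcases le_or_gt b (a + 1) with hab | hab
  · have hι : gs.initialFactor a x = x * gs.Δ ^ (-a) := by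
      refine gs.pre_antisymm (gs.wedge_le_left _ _) (gs.pre_wedge_iff.2 ⟨gs.pre_refl _, ?_⟩)
      have := (gs.mul_zpow_pre_mul_zpow_iff (-a)).2 (gs.pre_trans hb (gs.zpow_pre_zpow hab))
      rwa [← zpow_add, add_neg_cancel_comm, zpow_one] at this
    rw [cycling, hι, conj_self_mul, zpow_pre_conj_zpow_iff] at h
    exact gs.zpow_pre_relSliding h
  · rw [cycling, zpow_pre_conj_iff] at h
    rw [relSliding, zpow_pre_conj_iff]
    have hι : gs.pre (gs.relPrefix a b x) (gs.initialFactor a x) := by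
      simp only [relPrefix, initialFactor, pre_wedge_iff]
      exact ⟨gs.pre_trans (gs.wedge_le_left _ _) (gs.wedge_le_left _ _), gs.wedge_le_right _ _⟩
    have hx : x * gs.relPrefix a b x = gs.wedge (x * gs.initialFactor a x) (gs.Δ ^ b) := by
      refine gs.eq_of_forall_pre_iff fun c => ?_
      simp only [relPrefix, initialFactor, mul_wedge, pre_wedge_iff, mul_inv_cancel_left]
      tauto
    rw [hx, pre_wedge_iff]
    refine ⟨gs.pre_trans ((gs.mul_zpow_pre_mul_zpow_iff _).2 hι) h, ?_⟩
    refine gs.pre_trans ((gs.mul_zpow_pre_mul_zpow_iff _).2 (gs.wedge_le_right _ _)) ?_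
    rw [← zpow_one_add]
    exact gs.zpow_pre_zpow (by omega)

/-- Iterated cycling increases the infimum unless it is already maximal in the conjugacy class. -/
lemma exists_iterate_cycling {a : ℤ} {n : ℕ} {γ x y : G} (hγ : γ ∈ gs.P) (hn : gs.NormLE γ n)
    (hxy : γ * x = y * γ) (hy : gs.pre (gs.Δ ^ (a + 1)) y) (hx : gs.pre (gs.Δ ^ a) x) :
    ∃ k : ℕ, gs.pre (gs.Δ ^ (a + 1)) ((gs.cycling a)^[k] x) := by
  induction n using Nat.strong_induction_on generalizing γ x y with
  | _ n ih =>
    by_cases hd : (gs.initialFactor a x)⁻¹ * gs.Δ = 1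
    · refine ⟨0, ?_⟩
      have h1 : gs.pre gs.Δ (x * gs.Δ ^ (-a)) := by
        have h2 : gs.pre (gs.initialFactor a x) (x * gs.Δ ^ (-a)) := gs.wedge_le_left _ _
        rwa [inv_mul_eq_one.mp hd] at h2
      rw [pre_mul_zpow_iff, neg_neg, ← zpow_one_add, add_comm] at h1
      exact h1
    · set ι := gs.initialFactor a x with hι
      have hγ' : gs.Δ⁻¹ * γ * ι ∈ gs.P := by
        have h1 : gs.pre gs.Δ (γ * ι) := by
          rw [hι, initialFactor, mul_wedge, pre_wedge_iff]
          constructor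
          · rw [← mul_assoc, hxy, pre_mul_zpow_iff, neg_neg, ← zpow_one_add, add_comm]
            exact gs.pre_trans hy (gs.pre_mul_of_mem hγ)
          · simpa using gs.zpow_pre_mul_zpow (n := 1) hγ
        simpa [pre, mul_assoc] using h1
      obtain ⟨m, hm, hm'⟩ := gs.exists_normLE_lt_of_mul (x := gs.Δ⁻¹ * γ * ι) (c := ι⁻¹ * gs.Δ)
        (gs.wedge_le_right _ _) hd (by
          have := gs.normLE_conj_Delta hn
          simpa only [mul_assoc, mul_inv_cancel_left] using this) hγ'
      have hconj : gs.Δ⁻¹ * γ * ι * gs.cycling a x =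
          (gs.Δ⁻¹ * y * gs.Δ) * (gs.Δ⁻¹ * γ * ι) := by
        have : γ * (x * ι) = y * (γ * ι) := by rw [← mul_assoc, hxy, mul_assoc]
        simp only [cycling, ← hι, mul_assoc, mul_inv_cancel_left, this]
      obtain ⟨k, hk⟩ := ih m hm hγ' hm' hconj
        (by simpa using (gs.zpow_pre_conj_zpow_iff 1).2 hy) (gs.zpow_pre_cycling hx)
      exact ⟨k + 1, hk⟩

lemma zpow_pre_iterate_relSliding {a b c : ℤ} {x : G} (hc : gs.pre (gs.Δ ^ c) x) (n : ℕ) :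
    gs.pre (gs.Δ ^ c) ((gs.relSliding a b)^[n] x) := by
  induction n with
  | zero => exact hc
  | succ n ih => rw [Function.iterate_succ_apply']; exact gs.zpow_pre_relSliding ih

lemma zpow_pre_of_iterate_cycling {a b : ℤ} {z : G} {m : ℕ} (hm : 1 ≤ m)
    (hz : (gs.relSliding a b)^[m] z = z) (hb : gs.pre z (gs.Δ ^ b)) {k : ℕ}
    (hk : gs.pre (gs.Δ ^ (a + 1)) ((gs.cycling a)^[k] z)) : gs.pre (gs.Δ ^ (a + 1)) z := by
  induction k generalizing z with
  | zero => exact hk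
  | succ k ih =>
    have hcomm : Function.Commute (gs.relSliding a b) (gs.cycling a) :=
      fun x => (gs.cycling_relSliding a b x).symm
    have hcyc : (gs.relSliding a b)^[m] (gs.cycling a z) = gs.cycling a z := by
      rw [(hcomm.iterate_left m).eq, hz]
    have h := gs.zpow_pre_relSliding_of_cycling hb (ih hcyc (gs.cycling_pre_zpow hb) hk)
    obtain ⟨m, rfl⟩ := Nat.exists_eq_add_of_le' hm
    rw [← hz, Function.iterate_succ_apply]
    exact gs.zpow_pre_iterate_relSliding h m

/-- The infimum is maximal along a circuit for relative cyclic sliding. -/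
lemma zpow_pre_of_relSliding_circuit {a b : ℤ} {z α : G} {m : ℕ} (hm : 1 ≤ m)
    (hz : (gs.relSliding a b)^[m] z = z) (ha : gs.pre (gs.Δ ^ a) z) (hb : gs.pre z (gs.Δ ^ b))
    (hα : gs.pre (gs.Δ ^ (a + 1)) (α⁻¹ * z * α)) : gs.pre (gs.Δ ^ (a + 1)) z := by
  obtain ⟨-, q, -, hq⟩ := gs.exists_zpow_pre_pre_zpow α
  have hγ : gs.Δ ^ q * α⁻¹ ∈ gs.P := by
    simpa [pre] using gs.zpow_neg_pre_inv_iff.2 hq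
  obtain ⟨n, hn⟩ := gs.exists_normLE hγ
  obtain ⟨k, hk⟩ := gs.exists_iterate_cycling (x := z)
    (y := (gs.Δ ^ (-q))⁻¹ * (α⁻¹ * z * α) * gs.Δ ^ (-q)) hγ hn
    (by simp [mul_assoc]) ((gs.zpow_pre_conj_zpow_iff _).2 hα) ha
  exact gs.zpow_pre_of_iterate_cycling hm hz hb hk

end Relative

/-! ### Sliding circuits lie in the super summit set -/

section SuperSummit

variable {gs : GarsideStructure G}

lemma sl_eq_relSliding {a b : ℤ} {x : G} (ha : gs.ginf x = a) (hb : gs.gsup x = b) :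
    gs.sl x = gs.relSliding a b x := by
  subst ha hb; rfl

lemma ginf_le_ginf_sl (hΔ : gs.Δ ≠ 1) (x : G) : gs.ginf x ≤ gs.ginf (gs.sl x) := by
  rw [gs.le_ginf_iff hΔ, sl_eq_relSliding rfl rfl]
  exact gs.zpow_pre_relSliding ((gs.le_ginf_iff hΔ).1 le_rfl)

lemma gsup_sl_le_gsup (hΔ : gs.Δ ≠ 1) (x : G) : gs.gsup (gs.sl x) ≤ gs.gsup x := by
  rw [gs.gsup_le_iff hΔ, sl_eq_relSliding rfl rfl]
  exact gs.relSliding_pre_zpow ((gs.gsup_le_iff hΔ).1 le_rfl)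

lemma iterate_sl_eq_iterate_relSliding (hΔ : gs.Δ ≠ 1) {z : G} {m : ℕ} (hm : 1 ≤ m)
    (hz : gs.sl^[m] z = z) (n : ℕ) :
    gs.sl^[n] z = (gs.relSliding (gs.ginf z) (gs.gsup z))^[n] z := by
  have hinf : Monotone fun i => gs.ginf (gs.sl^[i] z) := monotone_nat_of_le_succ fun i => by
    rw [Function.iterate_succ_apply']; exact ginf_le_ginf_sl hΔ _
  have hsup : Antitone fun i => gs.gsup (gs.sl^[i] z) := antitone_nat_of_succ_le fun i => by
    rw [Function.iterate_succ_apply']; exact gsup_sl_le_gsup hΔ _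
  have hper : ∀ i, gs.sl^[m * i] z = z := fun i => by
    rw [Function.iterate_mul]; exact Function.iterate_fixed hz i
  have hle : ∀ i, i ≤ m * i := fun i => Nat.le_mul_of_pos_left i hm
  induction n with
  | zero => rfl
  | succ n ih =>
    rw [Function.iterate_succ_apply', Function.iterate_succ_apply', ← ih]
    refine sl_eq_relSliding (le_antisymm ?_ (hinf n.zero_le)) (le_antisymm (hsup n.zero_le) ?_)
    · simpa [hper] using hinf (hle n)
    · simpa [hper] using hsup (hle n)

lemma SC_subset_SSS (hΔ : gs.Δ ≠ 1) (x : G) : gs.SC x ⊆ gs.SSS x := by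
  rintro z ⟨⟨α, rfl⟩, m, hm, hz⟩
  set z := α⁻¹ * x * α with hzdef
  have hcirc := hz
  rw [iterate_sl_eq_iterate_relSliding hΔ hm hz] at hcirc
  have ha : gs.pre (gs.Δ ^ gs.ginf z) z := (gs.le_ginf_iff hΔ).1 le_rfl
  have hb : gs.pre z (gs.Δ ^ gs.gsup z) := (gs.gsup_le_iff hΔ).1 le_rfl
  refine ⟨⟨α, rfl⟩, ?_⟩
  rintro _ ⟨β, rfl⟩
  have hconj : β⁻¹ * x * β = (α⁻¹ * β)⁻¹ * z * (α⁻¹ * β) := by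
    simp only [hzdef, mul_inv_rev, inv_inv, mul_assoc, mul_inv_cancel_left]
  constructor
  · by_contra! hlt
    have h := gs.zpow_pre_of_relSliding_circuit (α := α⁻¹ * β) hm hcirc ha hb
      (by rw [← hconj, ← gs.le_ginf_iff hΔ]; omega)
    rw [← gs.le_ginf_iff hΔ] at h
    omega
  · by_contra! hlt
    have hcirc' : (gs.relSliding (-gs.gsup z) (-gs.ginf z))^[m] z⁻¹ = z⁻¹ := by
      have hsemi : Function.Semiconj (·⁻¹) (gs.relSliding (gs.ginf z) (gs.gsup z))
          (gs.relSliding (-gs.gsup z) (-gs.ginf z)) :=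
        fun w => (gs.relSliding_inv _ _ w).symm
      rw [← (hsemi.iterate_right m).eq, hcirc]
    have h := gs.zpow_pre_of_relSliding_circuit (α := α⁻¹ * β) hm hcirc'
      (gs.zpow_neg_pre_inv_iff.2 hb) (gs.inv_pre_zpow_neg_iff.2 ha) (by
        have e : (α⁻¹ * β)⁻¹ * z⁻¹ * (α⁻¹ * β) = (β⁻¹ * x * β)⁻¹ := by
          rw [hconj]; simp only [mul_inv_rev, inv_inv, mul_assoc]
        rw [e, show -gs.gsup z + 1 = -(gs.gsup z - 1) by ring, zpow_neg_pre_inv_iff,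
          ← gs.gsup_le_iff hΔ]
        omega)
    rw [show -gs.gsup z + 1 = -(gs.gsup z - 1) by ring, zpow_neg_pre_inv_iff,
      ← gs.gsup_le_iff hΔ] at h
    omega

/-- Membership of conjugates in the super summit set, in terms of a given member. -/
lemma conj_mem_SSS_iff (hΔ : gs.Δ ≠ 1) {x z u : G} (hz : z ∈ gs.SSS x) :
    u⁻¹ * z * u ∈ gs.SSS x ↔ gs.pre (gs.Δ ^ gs.ginf z) (u⁻¹ * z * u) ∧
      gs.pre (u⁻¹ * z * u) (gs.Δ ^ gs.gsup z) := by
  obtain ⟨⟨α, hα⟩, hmax⟩ := hz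
  have hu : ∃ β : G, β⁻¹ * x * β = u⁻¹ * z * u := ⟨α * u, by rw [← hα, conj_conj]⟩
  rw [← gs.le_ginf_iff hΔ, ← gs.gsup_le_iff hΔ]
  refine ⟨fun h => h.2 z ⟨α, hα⟩, fun h => ⟨hu, fun w hw => ?_⟩⟩
  exact ⟨(hmax w hw).1.trans h.1, h.2.trans (hmax w hw).2⟩

lemma ginf_eq_of_mem_SSS {x z w : G} (hz : z ∈ gs.SSS x) (hw : w ∈ gs.SSS x) :
    gs.ginf w = gs.ginf z :=
  le_antisymm (hz.2 w hw.1).1 (hw.2 z hz.1).1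

lemma gsup_eq_of_mem_SSS {x z w : G} (hz : z ∈ gs.SSS x) (hw : w ∈ gs.SSS x) :
    gs.gsup w = gs.gsup z :=
  le_antisymm (hw.2 z hz.1).2 (hz.2 w hw.1).2

lemma sl_mem_SSS (hΔ : gs.Δ ≠ 1) {x z : G} (hz : z ∈ gs.SSS x) : gs.sl z ∈ gs.SSS x :=
  (conj_mem_SSS_iff hΔ hz).2 ⟨gs.zpow_pre_relSliding ((gs.le_ginf_iff hΔ).1 le_rfl),
    gs.relSliding_pre_zpow ((gs.gsup_le_iff hΔ).1 le_rfl)⟩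

end SuperSummit

/-! ### Transport and pullback -/

section Transport

variable {gs : GarsideStructure G}

lemma conj_transport (z u : G) :
    (gs.transport z u)⁻¹ * gs.sl z * gs.transport z u = gs.sl (u⁻¹ * z * u) := by
  simp only [transport, sl, mul_inv_rev, inv_inv, mul_assoc, mul_inv_cancel_left]

lemma transport_mul (z u v : G) :
    gs.transport z (u * v) = gs.transport z u * gs.transport (u⁻¹ * z * u) v := by
  simp only [transport, mul_inv_rev, mul_assoc, mul_inv_cancel_left]

lemma transportIter_succ' (z u : G) (k : ℕ) :
    gs.transportIter z u (k + 1) = gs.transportIter (gs.sl z) (gs.transport z u) k := by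
  induction k with
  | zero => rfl
  | succ k ih =>
    rw [transportIter, ih, Function.iterate_succ_apply]
    rfl

lemma transportIter_mul (z u v : G) (k : ℕ) :
    gs.transportIter z (u * v) k =
      gs.transportIter z u k * gs.transportIter (u⁻¹ * z * u) v k := by
  induction k generalizing z u v with
  | zero => rfl
  | succ k ih => simp only [transportIter_succ', transport_mul, ih, conj_transport]

/-- The transport of `u` at `z` in terms of meets of elements depending linearly on `u`. -/
lemma pp_mul_transport {x z u : G} (hz : z ∈ gs.SSS x) (hu : u⁻¹ * z * u ∈ gs.SSS x) :
    gs.pp z * gs.transport z u =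
      gs.wedge (gs.wedge (z * u * gs.Δ ^ (-gs.ginf z)) (z⁻¹ * u * gs.Δ ^ gs.gsup z))
        (u * gs.Δ) := by
  have hpp : gs.pp (u⁻¹ * z * u) = gs.relPrefix (gs.ginf z) (gs.gsup z) (u⁻¹ * z * u) := by
    rw [pp, relPrefix, ginf_eq_of_mem_SSS hz hu, gsup_eq_of_mem_SSS hz hu]
  rw [transport, mul_assoc, mul_inv_cancel_left, hpp, mul_relPrefix_conj]

lemma pre_transport_iff {x z u s : G} (hz : z ∈ gs.SSS x) (hu : u⁻¹ * z * u ∈ gs.SSS x) :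
    gs.pre s (gs.transport z u) ↔
      (gs.pre (gs.pp z * s) (z * u * gs.Δ ^ (-gs.ginf z)) ∧
        gs.pre (gs.pp z * s) (z⁻¹ * u * gs.Δ ^ gs.gsup z)) ∧ gs.pre (gs.pp z * s) (u * gs.Δ) := by
  rw [← gs.mul_pre_mul_left_iff (gs.pp z), pp_mul_transport hz hu, pre_wedge_iff, pre_wedge_iff]

lemma pp_pre (z : G) : (gs.pre (gs.pp z) (z * gs.Δ ^ (-gs.ginf z)) ∧
    gs.pre (gs.pp z) (z⁻¹ * gs.Δ ^ gs.gsup z)) ∧ gs.pre (gs.pp z) gs.Δ := by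
  have h : gs.pre (gs.pp z) (gs.relPrefix (gs.ginf z) (gs.gsup z) z) := gs.pre_refl _
  rwa [relPrefix, pre_wedge_iff, pre_wedge_iff] at h

lemma transport_mem {x z u : G} (hz : z ∈ gs.SSS x) (hu : u⁻¹ * z * u ∈ gs.SSS x)
    (hP : u ∈ gs.P) : gs.transport z u ∈ gs.P := by
  rw [← one_pre_iff, pre_transport_iff hz hu, mul_one]
  obtain ⟨⟨h1, h2⟩, h3⟩ := gs.pp_pre z
  refine ⟨⟨gs.pre_trans h1 ?_, gs.pre_trans h2 ?_⟩, gs.pre_trans h3 ?_⟩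
  · exact (gs.mul_zpow_pre_mul_zpow_iff _).2 (gs.pre_mul_of_mem hP)
  · exact (gs.mul_zpow_pre_mul_zpow_iff _).2 (gs.pre_mul_of_mem hP)
  · simpa using gs.zpow_pre_mul_zpow (n := 1) hP

lemma transportIter_mem (hΔ : gs.Δ ≠ 1) {x z u : G} (hz : z ∈ gs.SSS x)
    (hu : u⁻¹ * z * u ∈ gs.SSS x) (hP : u ∈ gs.P) (k : ℕ) : gs.transportIter z u k ∈ gs.P := by
  induction k generalizing z u with
  | zero => exact hP
  | succ k ih =>
    rw [transportIter_succ']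
    refine ih (sl_mem_SSS hΔ hz) ?_ (transport_mem hz hu hP)
    rw [conj_transport]
    exact sl_mem_SSS hΔ hu

lemma transportIter_mono (hΔ : gs.Δ ≠ 1) {x z u v : G}
    (hu : u⁻¹ * z * u ∈ gs.SSS x) (hv : v⁻¹ * z * v ∈ gs.SSS x) (huv : gs.pre u v) (k : ℕ) :
    gs.pre (gs.transportIter z u k) (gs.transportIter z v k) := by
  obtain ⟨w, rfl⟩ : ∃ w, v = u * w := ⟨u⁻¹ * v, by simp⟩
  rw [transportIter_mul]
  refine gs.pre_mul_of_mem (transportIter_mem hΔ hu ?_ (by simpa [pre] using huv) k)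
  rwa [conj_conj]

lemma exists_isPullback (hΔ : gs.Δ ≠ 1) {x z s : G} (hz : z ∈ gs.SSS x) (hs : s ∈ gs.P) :
    ∃ u, gs.IsPullback x z s u := by
  set U : Set G := {u | u ∈ gs.P ∧ u⁻¹ * z * u ∈ gs.SSS x ∧ gs.pre s (gs.transport z u)} with hU
  have hne : U.Nonempty := by
    obtain ⟨-, q, -, hq⟩ := gs.exists_zpow_pre_pre_zpow s
    have hpos : gs.Δ ^ q ∈ gs.P :=
      gs.one_pre_iff.1 (gs.pre_trans (gs.one_pre_iff.2 hs) hq)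
    have hmem : (gs.Δ ^ q)⁻¹ * z * gs.Δ ^ q ∈ gs.SSS x := by
      rw [conj_mem_SSS_iff hΔ hz, zpow_pre_conj_zpow_iff, conj_zpow_pre_zpow_iff,
        ← gs.le_ginf_iff hΔ, ← gs.gsup_le_iff hΔ]
      exact ⟨le_rfl, le_rfl⟩
    refine ⟨gs.Δ ^ q, hpos, hmem, (pre_transport_iff hz hmem).2 ?_⟩
    have hle : gs.pre (gs.pp z * s) (gs.pp z * gs.Δ ^ q) := (gs.mul_pre_mul_left_iff _).2 hq
    obtain ⟨⟨h1, h2⟩, h3⟩ := gs.pp_pre z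
    refine ⟨⟨gs.pre_trans hle ?_, gs.pre_trans hle ?_⟩, gs.pre_trans hle ?_⟩
    · have := (gs.mul_zpow_pre_mul_zpow_iff q).2 h1
      rwa [mul_assoc, ← zpow_add, add_comm, zpow_add, ← mul_assoc] at this
    · have := (gs.mul_zpow_pre_mul_zpow_iff q).2 h2
      rwa [mul_assoc, ← zpow_add, add_comm, zpow_add, ← mul_assoc] at this
    · have := (gs.mul_zpow_pre_mul_zpow_iff q).2 h3
      rwa [← zpow_one_add, add_comm, zpow_add_one] at this
  obtain ⟨u, ⟨huP, huS, hus⟩, hmin⟩ := gs.exists_least hne (fun u hu => hu.1) (by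
    rintro u ⟨huP, huS, hus⟩ v ⟨hvP, hvS, hvs⟩
    have hw : (gs.wedge u v)⁻¹ * z * gs.wedge u v ∈ gs.SSS x := by
      have hu' := (conj_mem_SSS_iff hΔ hz).1 huS
      have hv' := (conj_mem_SSS_iff hΔ hz).1 hvS
      exact (conj_mem_SSS_iff hΔ hz).2
        ⟨gs.zpow_pre_conj_wedge hu'.1 hv'.1, gs.conj_wedge_pre_zpow hu'.2 hv'.2⟩
    refine ⟨gs.wedge_mem huP hvP, hw, ?_⟩
    rw [pre_transport_iff hz huS] at hus
    rw [pre_transport_iff hz hvS] at hvs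
    rw [pre_transport_iff hz hw]
    simp only [mul_wedge, wedge_mul_zpow, wedge_mul_Delta, pre_wedge_iff]
    tauto)
  exact ⟨u, huP, huS, hus, fun v h1 h2 h3 => hmin v ⟨h1, h2, h3⟩⟩

lemma isPullback_pullbackOne (hΔ : gs.Δ ≠ 1) {x z s : G} (hz : z ∈ gs.SSS x) (hs : s ∈ gs.P) :
    gs.IsPullback x z s (gs.pullbackOne x z s) :=
  Classical.epsilon_spec (exists_isPullback hΔ hz hs)

/-- The characterization of iterated pullbacks holds on the whole super summit set. -/
lemma pullbackIter_spec (hΔ : gs.Δ ≠ 1) {x z s : G} (hz : z ∈ gs.SSS x) (hs : s ∈ gs.P) (k : ℕ) :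
    gs.pullbackIter x z (k + 1) s ∈ gs.P ∧
    (gs.pullbackIter x z (k + 1) s)⁻¹ * z * gs.pullbackIter x z (k + 1) s ∈ gs.SSS x ∧
    gs.pre s (gs.transportIter z (gs.pullbackIter x z (k + 1) s) (k + 1)) ∧
    ∀ u : G, u ∈ gs.P → u⁻¹ * z * u ∈ gs.SSS x →
      gs.pre s (gs.transportIter z u (k + 1)) → gs.pre (gs.pullbackIter x z (k + 1) s) u := by
  induction k generalizing z with
  | zero => exact isPullback_pullbackOne hΔ hz hs
  | succ k ih =>
    have hsl := sl_mem_SSS hΔ hz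
    obtain ⟨hP, hS, hpre, hmin⟩ := ih hsl
    obtain ⟨hP', hS', hpre', hmin'⟩ := isPullback_pullbackOne hΔ hz hP
    refine ⟨hP', hS', ?_, fun u huP huS hus => hmin' u huP huS ?_⟩
    · rw [transportIter_succ']
      refine gs.pre_trans hpre (transportIter_mono hΔ hS ?_ hpre' (k + 1))
      rw [conj_transport]
      exact sl_mem_SSS hΔ hS'
    · rw [transportIter_succ'] at hus
      refine hmin _ (transport_mem hz huS huP) ?_ hus
      rw [conj_transport]
      exact sl_mem_SSS hΔ huS

end Transport

end GarsideStructure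

/-- The `k`-fold pullback `s_{(k)}` of `s` at `y = 𝔰^k(z)` is the `⪯`-minimal positive
element `u` with `s ⪯ u^{(k)}` (k-fold transport at `z`) and `z^u ∈ SSS(x)`. -/
theorem iterated_pullback (gs : GarsideStructure G) (x z s : G)
    (hz : z ∈ gs.SC x) (k : ℕ) (hk : 0 < k) (hs : s ∈ gs.P) :
    gs.pullbackIter x z k s ∈ gs.P ∧
    (gs.pullbackIter x z k s)⁻¹ * z * gs.pullbackIter x z k s ∈ gs.SSS x ∧
    gs.pre s (gs.transportIter z (gs.pullbackIter x z k s) k) ∧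
    ∀ u : G, u ∈ gs.P → u⁻¹ * z * u ∈ gs.SSS x →
      gs.pre s (gs.transportIter z u k) → gs.pre (gs.pullbackIter x z k s) u := by
  by_cases hΔ : gs.Δ = 1
  · have := gs.subsingleton_of_Delta_eq_one hΔ
    have hmem : ∀ g : G, g ∈ gs.P := fun g => Subsingleton.elim 1 g ▸ gs.one_mem
    refine ⟨hmem _, ⟨⟨1, Subsingleton.elim _ _⟩, fun w _ => ?_⟩, hmem _, fun u _ _ _ => hmem _⟩
    rw [Subsingleton.elim w]
    exact ⟨le_rfl, le_rfl⟩
  · obtain ⟨k, rfl⟩ := Nat.exists_eq_add_of_le' hk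
    exact pullbackIter_spec hΔ (SC_subset_SSS hΔ x hz) hs k
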